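/- (Theorem 3 reduction: mixed operators in CoSaMP, stated conditionally on the CoSaMP guarantee.) Let A, Φ ∈ ℂ^{m×d}, let s ≥ 1, and suppose A satisfies the restricted isometry property with parameters (s, δ) for some 0 ≤ δ ≤ 0.1. Let x ∈ ℂ^d with x_s ≠ 0 satisfy α_s + β_s ≤ 1/(2 κ_A^{(s)}), where α_s = ‖x − x_s‖₂/‖x_s‖₂, β_s = ‖x − x_s‖₁/(√s ‖x_s‖₂), and κ_A^{(s)} = √(1+δ)/√(1−δ). Let e ∈ ℂ^m and b = Ax. Suppose x♯ ∈ ℂ^d satisfies the CoSaMP-type guarantee ‖x♯ − x‖₂ ≤ C ( ‖x − x_s‖₂ + ‖x − x_s‖₁/√s + ‖(A − Φ)x + e‖₂ ) for some constant C > 0. Then ‖x♯ − x‖₂ ≤ C ( ‖x − x_s‖₂ + ‖x − x_s‖₁/√s + (2/√0.9) ( ‖A − Φ‖₂ α_s + ‖A − Φ‖^{(s)} ) ‖b‖₂ + ‖e‖₂ ). -/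

import Mathlib

open scoped BigOperators

/-- The Euclidean (ℓ²) norm of a vector. -/
noncomputable def l2 {n : ℕ} (x : Fin n → ℂ) : ℝ := Real.sqrt (∑ i, ‖x i‖ ^ 2)

/-- The ℓ¹ norm of a vector. -/
noncomputable def l1 {n : ℕ} (x : Fin n → ℂ) : ℝ := ∑ i, ‖x i‖

/-- `x` has at most `s` nonzero entries. -/
def Sparse {n : ℕ} (s : ℕ) (x : Fin n → ℂ) : Prop :=
  ∃ T : Finset (Fin n), T.card ≤ s ∧ ∀ i ∉ T, x i = 0

/-- `A` satisfies the restricted isometry property with parameters `(s, δ)`. -/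
def RIP {m d : ℕ} (A : Matrix (Fin m) (Fin d) ℂ) (s : ℕ) (δ : ℝ) : Prop :=
  ∀ x : Fin d → ℂ, Sparse s x →
    (1 - δ) * (l2 x) ^ 2 ≤ (l2 (A.mulVec x)) ^ 2 ∧
      (l2 (A.mulVec x)) ^ 2 ≤ (1 + δ) * (l2 x) ^ 2

/-- The spectral norm `‖M‖₂` of a matrix. -/
noncomputable def specNorm {m d : ℕ} (M : Matrix (Fin m) (Fin d) ℂ) : ℝ :=
  sSup {r | ∃ x : Fin d → ℂ, l2 x ≤ 1 ∧ r = l2 (M.mulVec x)}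

/-- `‖M‖^{(s)}`: the largest spectral norm over all `s`-column submatrices of `M`,
equivalently the sup of `‖Mx‖₂` over `s`-sparse `x` with `‖x‖₂ ≤ 1`. -/
noncomputable def specNormS {m d : ℕ} (s : ℕ) (M : Matrix (Fin m) (Fin d) ℂ) : ℝ :=
  sSup {r | ∃ x : Fin d → ℂ, Sparse s x ∧ l2 x ≤ 1 ∧ r = l2 (M.mulVec x)}

/-- `xs` is a best `s`-sparse approximation of `x`: it keeps `s` entries of `x` of
largest magnitude (all entries if `x` has fewer than `s` coordinates) and sets the
others to zero. -/
def IsSparseApprox {n : ℕ} (s : ℕ) (x xs : Fin n → ℂ) : Prop :=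
  ∃ T : Finset (Fin n), T.card = min s n ∧
    (∀ i, xs i = if i ∈ T then x i else 0) ∧
    ∀ i ∈ T, ∀ j ∉ T, ‖x j‖ ≤ ‖x i‖

theorem l2_eq_norm {n : ℕ} (x : Fin n → ℂ) : l2 x = ‖WithLp.toLp 2 x‖ := by
  simp [l2, EuclideanSpace.norm_eq]

theorem l2_nonneg {n : ℕ} (x : Fin n → ℂ) : 0 ≤ l2 x := Real.sqrt_nonneg _

theorem l2_add_le {n : ℕ} (x y : Fin n → ℂ) : l2 (x + y) ≤ l2 x + l2 y := by
  simpa only [l2_eq_norm, WithLp.toLp_add] using norm_add_le _ _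

theorem l2_smul {n : ℕ} (c : ℂ) (x : Fin n → ℂ) : l2 (c • x) = ‖c‖ * l2 x := by
  simp only [l2_eq_norm, WithLp.toLp_smul, norm_smul]

theorem l2_eq_zero {n : ℕ} {x : Fin n → ℂ} : l2 x = 0 ↔ x = 0 := by
  rw [l2_eq_norm, norm_eq_zero, WithLp.toLp_eq_zero]

theorem exists_l2_mulVec_le {m d : ℕ} (M : Matrix (Fin m) (Fin d) ℂ) :
    ∃ c, 0 ≤ c ∧ ∀ x, l2 (M.mulVec x) ≤ c * l2 x := by
  refine ⟨‖(Matrix.toEuclideanLin M).toContinuousLinearMap‖, norm_nonneg _, fun x => ?_⟩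
  have := (Matrix.toEuclideanLin M).toContinuousLinearMap.le_opNorm (WithLp.toLp 2 x)
  simpa [l2_eq_norm] using this

theorem Sparse.smul {n s : ℕ} {x : Fin n → ℂ} (hx : Sparse s x) (c : ℂ) : Sparse s (c • x) := by
  obtain ⟨T, hT, h⟩ := hx
  exact ⟨T, hT, fun i hi => by simp [h i hi]⟩

theorem l2_mulVec_le_specNormS {m d s : ℕ} (M : Matrix (Fin m) (Fin d) ℂ) {x : Fin d → ℂ}
    (hx : Sparse s x) : l2 (M.mulVec x) ≤ specNormS s M * l2 x := by
  obtain ⟨c, hc, hM⟩ := exists_l2_mulVec_le M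
  rcases (l2_nonneg x).eq_or_lt with h0 | hpos
  · simpa [← h0] using hM x
  have hbdd : BddAbove {r | ∃ x : Fin d → ℂ, Sparse s x ∧ l2 x ≤ 1 ∧ r = l2 (M.mulVec x)} := by
    refine ⟨c, ?_⟩
    rintro _ ⟨y, -, hy, rfl⟩
    exact (hM y).trans (mul_le_of_le_one_right hc hy)
  have hnorm : ‖((l2 x)⁻¹ : ℂ)‖ = (l2 x)⁻¹ := by
    rw [norm_inv, Complex.norm_of_nonneg hpos.le]
  have hle : (l2 x)⁻¹ * l2 (M.mulVec x) ≤ specNormS s M := by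
    refine le_csSup hbdd ⟨((l2 x)⁻¹ : ℂ) • x, hx.smul _, ?_, ?_⟩
    · rw [l2_smul, hnorm, inv_mul_cancel₀ hpos.ne']
    · rw [Matrix.mulVec_smul, l2_smul, hnorm]
  rwa [inv_mul_le_iff₀ hpos, mul_comm] at hle

theorem sparse_self {n : ℕ} (x : Fin n → ℂ) : Sparse n x :=
  ⟨Finset.univ, by simp, by simp⟩

theorem l2_mulVec_le_specNorm {m d : ℕ} (M : Matrix (Fin m) (Fin d) ℂ) (x : Fin d → ℂ) :
    l2 (M.mulVec x) ≤ specNorm M * l2 x := by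
  have h : specNorm M = specNormS d M := by simp [specNorm, specNormS, sparse_self]
  exact h ▸ l2_mulVec_le_specNormS M (sparse_self x)

theorem sparse_indicator {n s : ℕ} (x : Fin n → ℂ) {T : Finset (Fin n)} (hT : T.card ≤ s) :
    Sparse s ((T : Set (Fin n)).indicator x) :=
  ⟨T, hT, fun i hi => by simp [hi]⟩

theorem l2_indicator {n : ℕ} (x : Fin n → ℂ) (T : Finset (Fin n)) :
    l2 ((T : Set (Fin n)).indicator x) = Real.sqrt (∑ i ∈ T, ‖x i‖ ^ 2) := by
  simp only [l2, Set.indicator_apply, Finset.mem_coe, apply_ite, norm_zero, ite_pow]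
  simp

theorem l2_indicator_le {n : ℕ} (x : Fin n → ℂ) (T : Finset (Fin n)) :
    l2 ((T : Set (Fin n)).indicator x) ≤ l2 x := by
  rw [l2_indicator]
  exact Real.sqrt_le_sqrt (Finset.sum_le_univ_sum_of_nonneg fun i => by positivity)

theorem l2_indicator_le_of_norm_le {n s : ℕ} {x : Fin n → ℂ} {T : Finset (Fin n)} {c : ℝ}
    (hT : T.card ≤ s) (hc : 0 ≤ c) (h : ∀ i ∈ T, ‖x i‖ ≤ c) :
    l2 ((T : Set (Fin n)).indicator x) ≤ Real.sqrt s * c := by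
  rw [l2_indicator, Real.sqrt_le_left (by positivity), mul_pow, Real.sq_sqrt s.cast_nonneg]
  calc ∑ i ∈ T, ‖x i‖ ^ 2 ≤ T.card • c ^ 2 :=
        Finset.sum_le_card_nsmul _ _ _ fun i hi => pow_le_pow_left₀ (norm_nonneg _) (h i hi) 2
    _ ≤ s * c ^ 2 := by
        rw [nsmul_eq_mul]
        gcongr

theorem exists_subset_card_eq_of_largest {ι : Type*} [DecidableEq ι] (f : ι → ℝ) {s : ℕ}
    {S : Finset ι} (hs : s ≤ S.card) :
    ∃ T ⊆ S, T.card = s ∧ ∀ i ∈ T, ∀ j ∈ S \ T, f j ≤ f i := by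
  induction s with
  | zero => exact ⟨∅, by simp⟩
  | succ s ih =>
    obtain ⟨T, hTS, hT, hle⟩ := ih (by omega)
    have hne : (S \ T).Nonempty := by
      rw [← Finset.card_pos, Finset.card_sdiff_of_subset hTS]
      omega
    obtain ⟨k, hk, hmax⟩ := Finset.exists_max_image (S \ T) f hne
    have hk' := Finset.mem_sdiff.1 hk
    refine ⟨insert k T, Finset.insert_subset hk'.1 hTS, by simp [hk'.2, hT], ?_⟩
    intro i hi j hj
    have hj' : j ∈ S \ T := by
      simp only [Finset.mem_sdiff, Finset.mem_insert] at hj ⊢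
      tauto
    rcases Finset.mem_insert.1 hi with rfl | hi
    · exact hmax j hj'
    · exact hle i hi j hj'

theorem l2_mulVec_indicator_le {m d s : ℕ} (hs : 1 ≤ s) {A : Matrix (Fin m) (Fin d) ℂ} {K : ℝ}
    (hK : 0 ≤ K) (hA : ∀ u, Sparse s u → l2 (A.mulVec u) ≤ K * l2 u) (x : Fin d → ℂ)
    (S : Finset (Fin d)) (B : ℝ)
    (hB : ∀ T ⊆ S, T.card ≤ s → l2 ((T : Set (Fin d)).indicator x) ≤ B) :
    l2 (A.mulVec ((S : Set (Fin d)).indicator x))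
      ≤ K * (B + (∑ i ∈ S, ‖x i‖) / Real.sqrt s) := by
  induction S using Finset.strongInduction generalizing B with
  | H S ih =>
  rcases le_or_gt S.card s with hS | hS
  · refine (hA _ (sparse_indicator x hS)).trans (mul_le_mul_of_nonneg_left ?_ hK)
    exact (hB S subset_rfl hS).trans (le_add_of_nonneg_right (by positivity))
  obtain ⟨T, hTS, hT, hle⟩ := exists_subset_card_eq_of_largest (fun i => ‖x i‖) hS.le
  have hne : T.Nonempty := by
    rw [← Finset.card_pos]
    omega
  obtain ⟨k, hk, hmin⟩ := Finset.exists_min_image T (fun i => ‖x i‖) hne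
  have hsplit : (S : Set (Fin d)).indicator x
      = (T : Set (Fin d)).indicator x + ((S \ T : Finset (Fin d)) : Set (Fin d)).indicator x := by
    ext i
    by_cases h1 : i ∈ T
    · simp [h1, hTS h1]
    · simp [h1, Set.indicator_apply]
  have hrest := ih (S \ T) (Finset.sdiff_ssubset hTS hne) (Real.sqrt s * ‖x k‖)
    fun T' hT' hcard => l2_indicator_le_of_norm_le hcard (norm_nonneg _)
      fun j hj => hle k hk j (hT' hj)
  have hs0 : 0 < Real.sqrt s := Real.sqrt_pos.2 (by exact_mod_cast hs)
  have hsum : Real.sqrt s * ‖x k‖ ≤ (∑ i ∈ T, ‖x i‖) / Real.sqrt s := by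
    rw [le_div_iff₀ hs0, mul_right_comm, Real.mul_self_sqrt s.cast_nonneg]
    simpa [hT] using Finset.card_nsmul_le_sum T (fun i => ‖x i‖) _ hmin
  have htop : l2 (A.mulVec ((T : Set (Fin d)).indicator x)) ≤ K * B :=
    (hA _ (sparse_indicator x hT.le)).trans (mul_le_mul_of_nonneg_left (hB T hTS hT.le) hK)
  rw [hsplit, Matrix.mulVec_add]
  calc _ ≤ _ := l2_add_le _ _
    _ ≤ K * B + K * (Real.sqrt s * ‖x k‖ + (∑ i ∈ S \ T, ‖x i‖) / Real.sqrt s) :=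
        add_le_add htop hrest
    _ ≤ K * B + K * ((∑ i ∈ T, ‖x i‖) / Real.sqrt s + (∑ i ∈ S \ T, ‖x i‖) / Real.sqrt s) := by
        gcongr
    _ = _ := by
        rw [← Finset.sum_sdiff hTS]
        ring

theorem l2_mulVec_le_of_sparse {m d s : ℕ} (hs : 1 ≤ s) {A : Matrix (Fin m) (Fin d) ℂ} {K : ℝ}
    (hK : 0 ≤ K) (hA : ∀ u, Sparse s u → l2 (A.mulVec u) ≤ K * l2 u) (x : Fin d → ℂ) :
    l2 (A.mulVec x) ≤ K * (l2 x + l1 x / Real.sqrt s) := by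
  simpa [l1] using l2_mulVec_indicator_le hs hK hA x Finset.univ (l2 x)
    fun T _ _ => l2_indicator_le x T

theorem RIP.l2_mulVec_le {m d s : ℕ} {A : Matrix (Fin m) (Fin d) ℂ} {δ : ℝ} (hA : RIP A s δ)
    (hδ : 0 ≤ 1 + δ) {x : Fin d → ℂ} (hx : Sparse s x) :
    l2 (A.mulVec x) ≤ Real.sqrt (1 + δ) * l2 x := by
  refine (sq_le_sq₀ (l2_nonneg _) (mul_nonneg (Real.sqrt_nonneg _) (l2_nonneg _))).1 ?_
  rw [mul_pow, Real.sq_sqrt hδ]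
  exact (hA x hx).2

theorem RIP.le_l2_mulVec {m d s : ℕ} {A : Matrix (Fin m) (Fin d) ℂ} {δ : ℝ} (hA : RIP A s δ)
    (hδ : 0 ≤ 1 - δ) {x : Fin d → ℂ} (hx : Sparse s x) :
    Real.sqrt (1 - δ) * l2 x ≤ l2 (A.mulVec x) := by
  refine (sq_le_sq₀ (mul_nonneg (Real.sqrt_nonneg _) (l2_nonneg _)) (l2_nonneg _)).1 ?_
  rw [mul_pow, Real.sq_sqrt hδ]
  exact (hA x hx).1

/-- Theorem 3 reduction: mixed operators in CoSaMP, stated conditionally on the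
CoSaMP-type guarantee. -/
theorem cosamp_mixed_operators (m d s : ℕ) (hs : 1 ≤ s)
    (A Φ : Matrix (Fin m) (Fin d) ℂ)
    (δ : ℝ) (hδ0 : 0 ≤ δ) (hδ1 : δ ≤ 0.1) (hRIP : RIP A s δ)
    (x xs : Fin d → ℂ) (hxs : IsSparseApprox s x xs) (hxs0 : xs ≠ 0)
    -- `α_s + β_s ≤ 1 / (2 κ_A^{(s)})`
    (hcond : l2 (x - xs) / l2 xs + l1 (x - xs) / (Real.sqrt s * l2 xs)
        ≤ 1 / (2 * (Real.sqrt (1 + δ) / Real.sqrt (1 - δ))))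
    (e : Fin m → ℂ) (xsharp : Fin d → ℂ) (C : ℝ) (hC : 0 < C)
    -- the CoSaMP-type guarantee with total noise `(A - Φ)x + e`
    (hguar : l2 (xsharp - x)
        ≤ C * (l2 (x - xs) + l1 (x - xs) / Real.sqrt s
            + l2 ((A - Φ).mulVec x + e))) :
    l2 (xsharp - x)
      ≤ C * (l2 (x - xs) + l1 (x - xs) / Real.sqrt s
          + 2 / Real.sqrt 0.9
              * (specNorm (A - Φ) * (l2 (x - xs) / l2 xs) + specNormS s (A - Φ))
              * l2 (A.mulVec x)
          + l2 e) := by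
  have hsparse : Sparse s xs := by
    obtain ⟨T, hT, h, -⟩ := hxs
    exact ⟨T, hT.trans_le (min_le_left _ _), fun i hi => by simp [h i, hi]⟩
  have hpos : 0 < l2 xs := (l2_nonneg _).lt_of_ne' (l2_eq_zero.not.2 hxs0)
  have hs0 : 0 < Real.sqrt s := Real.sqrt_pos.2 (by exact_mod_cast hs)
  have hp : 0 < Real.sqrt (1 + δ) := Real.sqrt_pos.2 (by linarith)
  have hq : 0 < Real.sqrt (1 - δ) := Real.sqrt_pos.2 (by linarith)
  have hq' : Real.sqrt 0.9 ≤ Real.sqrt (1 - δ) := Real.sqrt_le_sqrt (by linarith)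
  have hlow := hRIP.le_l2_mulVec (by linarith) hsparse
  have htail := l2_mulVec_le_of_sparse hs hp.le
    (fun u hu => hRIP.l2_mulVec_le (by linarith) hu) (x - xs)
  have hneg : l2 (A.mulVec xs) ≤ l2 (A.mulVec x) + l2 (A.mulVec (x - xs)) := by
    have h := l2_add_le (A.mulVec x) ((-1 : ℂ) • A.mulVec (x - xs))
    rw [l2_smul] at h
    simpa [Matrix.mulVec_sub] using h
  have hcond' : Real.sqrt (1 + δ) * (l2 (x - xs) + l1 (x - xs) / Real.sqrt s)
      ≤ Real.sqrt (1 - δ) / 2 * l2 xs := by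
    have h := mul_le_mul_of_nonneg_left hcond (mul_pos hp hpos).le
    calc _ = _ := by field_simp
      _ ≤ _ := h
      _ = _ := by field_simp
  have hb : l2 xs ≤ 2 / Real.sqrt 0.9 * l2 (A.mulVec x) := by
    have h9 : 0 < Real.sqrt 0.9 := Real.sqrt_pos.2 (by norm_num)
    rw [div_mul_eq_mul_div, le_div_iff₀ h9]
    nlinarith
  set D := A - Φ
  have hsplit : D.mulVec x = D.mulVec (x - xs) + D.mulVec xs := by
    rw [← Matrix.mulVec_add, sub_add_cancel]
  have hN : 0 ≤ specNorm D := Real.sSup_nonneg (by rintro _ ⟨y, -, rfl⟩; exact l2_nonneg _)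
  have hNs : 0 ≤ specNormS s D := Real.sSup_nonneg (by rintro _ ⟨y, -, -, rfl⟩; exact l2_nonneg _)
  have hcoef : 0 ≤ specNorm D * (l2 (x - xs) / l2 xs) + specNormS s D :=
    add_nonneg (mul_nonneg hN (div_nonneg (l2_nonneg _) hpos.le)) hNs
  refine hguar.trans (mul_le_mul_of_nonneg_left ?_ hC.le)
  rw [add_assoc (_ + _)]
  refine add_le_add_right ?_ _
  refine (l2_add_le _ _).trans (add_le_add_left ?_ _)
  calc l2 (D.mulVec x) ≤ specNorm D * l2 (x - xs) + specNormS s D * l2 xs := by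
        rw [hsplit]
        exact (l2_add_le _ _).trans
          (add_le_add (l2_mulVec_le_specNorm D _) (l2_mulVec_le_specNormS D hsparse))
    _ = (specNorm D * (l2 (x - xs) / l2 xs) + specNormS s D) * l2 xs := by field_simp
    _ ≤ _ := mul_le_mul_of_nonneg_left hb hcoef
    _ = _ := by ring
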